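/- arXiv:2004.03652 — 2 statements merged into one kernel-verified Lean document; each statement's English description precedes it below -/
import Mathlib

section
/- Let φ satisfy assumptions (A1)–(A2) with α ∈ (0,2) and a₀ ≤ 1/2. Fix δ > 0, 0 < γ < δ/2, λ > 0, and let ω be the modulus of continuity ω(ξ) := δλ^{−1}ξ − (δ/4)λ^{−1−α/2}ξ^{1+α/2} for 0 < ξ ≤ λ and ω(ξ) := (3/4)δ + γ log(ξ/λ) for ξ > λ. Let ρ : ℝ → ℝ be smooth and 1-periodic with 0 ≤ ρ ≤ M₁ everywhere and |ρ(a)−ρ(b)| ≤ ω(|a−b|) for all a,b, and let x ≠ y satisfy ρ(x) − ρ(y) = ω(ξ) with ξ := |x−y| ∈ (0, r₀/2]. Then both −𝓛ρ(x) and 𝓛ρ(y) are bounded above by 2c₃M₁ + 4c₁ C̄_α δ λ^{−α/2} ξ^{−α/2} if 0 < ξ ≤ λ, and by 2c₃M₁ + (12c₁/α²) γ ξ^{−α} if λ < ξ ≤ r₀/2, where C̄_α := 1/(α²(1−α)) for 0 < α < 1, C̄_α := 2 for α = 1, and C̄_α := 1/(α−1) + 5/4 for 1 < α < 2. -/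
open Real MeasureTheory Filter Set Topology

noncomputable section

/-- Principal-value Lévy operator: (𝓛 f)(x) = p.v. ∫ φ(x-y)(f(x)-f(y)) dy. -/
def levy (φ f : ℝ → ℝ) (x : ℝ) : ℝ :=
  limUnder (nhdsWithin (0:ℝ) (Set.Ioi 0))
    (fun ε => ∫ y in {y : ℝ | ε ≤ |x - y|}, φ (x - y) * (f x - f y))

/-- Principal-value alignment force. -/
def alignForce (φ ρ u : ℝ → ℝ) (x : ℝ) : ℝ :=
  limUnder (nhdsWithin (0:ℝ) (Set.Ioi 0))
    (fun ε => ∫ y in {y : ℝ | ε ≤ |x - y|}, φ (x - y) * (u y - u x) * ρ y)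

/-- Periodization -/
def phiS (φ : ℝ → ℝ) (x : ℝ) : ℝ := ∑' k : ℤ, φ (x + (k : ℝ))

def supNorm (f : ℝ → ℝ) : ℝ := ⨆ x : ℝ, |f x|

structure A12 (φ : ℝ → ℝ) (α a₀ c₁ c₂ : ℝ) : Prop where
  αpos : 0 < α
  αlt : α < 2
  a₀pos : 0 < a₀
  a₀le : a₀ ≤ 1/2
  c₁ge : 1 ≤ c₁
  c₂pos : 0 < c₂
  even : ∀ x : ℝ, φ (-x) = φ x
  smooth : ContDiffOn ℝ 4 φ {(0:ℝ)}ᶜ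
  lower : ∀ x : ℝ, x ≠ 0 → |x| ≤ a₀ → c₁⁻¹ * |x| ^ (-(1+α)) ≤ φ x
  upper : ∀ x : ℝ, x ≠ 0 → |x| ≤ a₀ → φ x ≤ c₁ * |x| ^ (-(1+α))
  derivBound : ∀ j : ℕ, 1 ≤ j → j ≤ 4 → ∀ x : ℝ, x ≠ 0 → |x| ≤ a₀ →
    |iteratedDeriv j φ x| ≤ c₁ * |x| ^ (-(1+(j:ℝ)+α))
  mono : ∀ r s : ℝ, 0 < r → r ≤ s → s ≤ a₀ → φ s ≤ φ r
  tailInt : ∀ j : ℕ, j ≤ 4 →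
    IntegrableOn (fun x : ℝ => |x| ^ (j:ℝ) * |iteratedDeriv j φ x|) {x : ℝ | a₀ ≤ |x|}
  tailBound : ∀ j : ℕ, j ≤ 4 →
    (∫ x in {x : ℝ | a₀ ≤ |x|}, |x| ^ (j:ℝ) * |iteratedDeriv j φ x|) ≤ c₂

structure EASol (φ : ℝ → ℝ) (T : ℝ) (ρ u : ℝ → ℝ → ℝ) : Prop where
  smooth_rho : ContDiffOn ℝ (⊤ : ℕ∞) (Function.uncurry ρ) (Set.univ ×ˢ Set.Icc 0 T)
  smooth_u : ContDiffOn ℝ (⊤ : ℕ∞) (Function.uncurry u) (Set.univ ×ˢ Set.Icc 0 T)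
  periodic_rho : ∀ x t, ρ (x + 1) t = ρ x t
  periodic_u : ∀ x t, u (x + 1) t = u x t
  mass : ∀ x : ℝ, ∀ t ∈ Set.Icc 0 T,
    derivWithin (fun s => ρ x s) (Set.Icc 0 T) t + deriv (fun y => ρ y t * u y t) x = 0
  mom : ∀ x : ℝ, ∀ t ∈ Set.Icc 0 T,
    derivWithin (fun s => u x s) (Set.Icc 0 T) t + u x t * deriv (fun y => u y t) x
      = alignForce φ (fun y => ρ y t) (fun y => u y t) x

/-- The rescaled modulus of continuity `ω` with parameters `δ, γ, λ`. -/
def moc (α δ γ lam : ℝ) (ξ : ℝ) : ℝ :=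
  if ξ ≤ lam then δ * lam⁻¹ * ξ - δ / 4 * lam ^ (-(1:ℝ) - α/2) * ξ ^ (1 + α/2)
  else 3 * δ / 4 + γ * Real.log (ξ / lam)

/-- The constant `C̄_α`. -/
def Cbar (α : ℝ) : ℝ :=
  if α < 1 then 1 / (α^2 * (1 - α)) else if α = 1 then 2 else 1 / (α - 1) + 5/4

/-- The tangent line inequality for the convex power `t ↦ t ^ s`, `s ≥ 1`. -/
lemma rpow_tangent_le {p q s : ℝ} (hp : 0 < p) (hq : 0 ≤ q) (hs : 1 ≤ s) :
    p ^ s + s * p ^ (s - 1) * (q - p) ≤ q ^ s := by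
  have h1 := one_add_mul_self_le_rpow_one_add (s := q / p - 1)
    (by have := div_nonneg hq hp.le; linarith) hs
  have h2 : (1 + (q / p - 1)) ^ s = q ^ s / p ^ s := by
    rw [← Real.div_rpow hq hp.le]; ring_nf
  have hps : 0 < p ^ s := Real.rpow_pos_of_pos hp s
  rw [h2, le_div_iff₀ hps] at h1
  refine le_trans (le_of_eq ?_) h1
  rw [Real.rpow_sub_one hp.ne']
  field_simp

lemma moc_of_le {α δ γ lam ξ : ℝ} (h : ξ ≤ lam) :
    moc α δ γ lam ξ = δ * lam⁻¹ * ξ - δ / 4 * lam ^ (-(1:ℝ) - α/2) * ξ ^ (1 + α/2) :=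
  if_pos h

lemma moc_of_lt {α δ γ lam ξ : ℝ} (h : lam < ξ) :
    moc α δ γ lam ξ = 3 * δ / 4 + γ * Real.log (ξ / lam) :=
  if_neg h.not_ge

lemma moc_self {α δ γ lam : ℝ} (hlam : 0 < lam) : moc α δ γ lam lam = 3 * δ / 4 := by
  rw [moc_of_le le_rfl, mul_assoc (δ / 4), ← Real.rpow_add hlam]
  ring_nf
  rw [Real.rpow_zero, mul_assoc, mul_inv_cancel₀ hlam.ne']
  ring

lemma moc_zero {α δ γ lam : ℝ} (hα : 0 < α) (hlam : 0 < lam) : moc α δ γ lam 0 = 0 := by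
  rw [moc_of_le hlam.le, Real.zero_rpow (by positivity)]
  ring

lemma moc_of_ge {α δ γ lam ξ : ℝ} (hlam : 0 < lam) (h : lam ≤ ξ) :
    moc α δ γ lam ξ = 3 * δ / 4 + γ * Real.log (ξ / lam) := by
  rcases h.eq_or_lt with rfl | h
  · rw [moc_self hlam, div_self hlam.ne']; simp
  · exact moc_of_lt h

lemma log_div_tangent_le {p q lam : ℝ} (hlam : 0 < lam) (hp : 0 < p) (hq : 0 < q) :
    Real.log (q / lam) ≤ Real.log (p / lam) + p⁻¹ * (q - p) := by
  have h1 := Real.log_le_sub_one_of_pos (div_pos hq hp)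
  rw [Real.log_div hq.ne' hp.ne'] at h1
  rw [Real.log_div hq.ne' hlam.ne', Real.log_div hp.ne' hlam.ne']
  have : p⁻¹ * (q - p) = q / p - 1 := by field_simp
  linarith

/-- The modulus `moc` has a supporting line at each positive point. -/
lemma exists_moc_le_tangent {α δ γ lam p : ℝ} (hα : 0 < α) (hα2 : α < 2) (hδ : 0 < δ)
    (hγ0 : 0 < γ) (hγ : γ < δ / 2) (hlam : 0 < lam) (hp : 0 < p) :
    ∃ m, ∀ q, 0 ≤ q → moc α δ γ lam q ≤ moc α δ γ lam p + m * (q - p) := by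
  set κ : ℝ := δ / 4 * lam ^ (-(1:ℝ) - α/2) with hκ
  have hκ0 : 0 < κ := by positivity
  set slope : ℝ → ℝ := fun r => δ * lam⁻¹ - κ * ((1 + α/2) * r ^ (α/2)) with hslope
  have tangent : ∀ r q, 0 < r → r ≤ lam → 0 ≤ q → q ≤ lam →
      moc α δ γ lam q ≤ moc α δ γ lam r + slope r * (q - r) := by
    intro r q hr hrl hq hql
    have h1 := rpow_tangent_le hr hq (s := 1 + α/2) (by linarith)
    rw [show (1 + α/2 - 1 : ℝ) = α/2 by ring] at h1
    rw [moc_of_le hql, moc_of_le hrl, ← hκ]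
    have := mul_le_mul_of_nonneg_left h1 hκ0.le
    simp only [hslope]
    linarith
  have slope_ge : ∀ r, 0 < r → r ≤ lam → γ * lam⁻¹ ≤ slope r := by
    intro r hr hrl
    have h1 : r ^ (α/2) ≤ lam ^ (α/2) := Real.rpow_le_rpow hr.le hrl (by positivity)
    have h2 : κ * lam ^ (α/2) = δ / 4 * lam⁻¹ := by
      rw [hκ, mul_assoc, ← Real.rpow_add hlam, ← Real.rpow_neg_one]
      ring_nf
    have h3 : κ * r ^ (α/2) ≤ δ / 4 * lam⁻¹ := h2 ▸ mul_le_mul_of_nonneg_left h1 hκ0.le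
    have hil : 0 < lam⁻¹ := inv_pos.2 hlam
    have h4 : (1 + α/2) * (κ * r ^ (α/2)) ≤ 2 * (δ / 4 * lam⁻¹) :=
      mul_le_mul (by linarith) h3 (by positivity) (by norm_num)
    have h5 : γ * lam⁻¹ ≤ δ / 2 * lam⁻¹ := mul_le_mul_of_nonneg_right hγ.le hil.le
    simp only [hslope]
    linarith
  have log_tangent : ∀ r q, lam ≤ r → lam ≤ q →
      moc α δ γ lam q ≤ moc α δ γ lam r + γ * r⁻¹ * (q - r) := by
    intro r q hr hq
    have h1 := log_div_tangent_le hlam (hlam.trans_le hr) (hlam.trans_le hq)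
    rw [moc_of_ge hlam hq, moc_of_ge hlam hr]
    have := mul_le_mul_of_nonneg_left h1 hγ0.le
    linarith
  rcases le_or_gt p lam with hpl | hpl
  · refine ⟨slope p, fun q hq => ?_⟩
    rcases le_or_gt q lam with hql | hql
    · exact tangent p q hp hpl hq hql
    · have h1 := log_tangent lam q le_rfl hql.le
      have h2 := tangent p lam hp hpl hlam.le le_rfl
      have h3 := mul_le_mul_of_nonneg_right (slope_ge p hp hpl) (sub_nonneg.2 hql.le)
      linarith
  · refine ⟨γ * p⁻¹, fun q hq => ?_⟩
    rcases le_or_gt lam q with hql | hql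
    · exact log_tangent p q hpl.le hql
    · have h1 := tangent lam q hlam le_rfl hq hql.le
      have h2 := log_tangent p lam hpl.le le_rfl
      have h4 : γ * p⁻¹ ≤ γ * lam⁻¹ :=
        mul_le_mul_of_nonneg_left (inv_anti₀ hlam hpl.le) hγ0.le
      have h3 := mul_le_mul_of_nonneg_right (h4.trans (slope_ge lam hlam le_rfl))
        (sub_nonneg.2 hql.le)
      linarith

/-- Midpoint concavity of `moc`. -/
lemma moc_add_moc_sub_le {α δ γ lam p z : ℝ} (hα : 0 < α) (hα2 : α < 2) (hδ : 0 < δ)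
    (hγ0 : 0 < γ) (hγ : γ < δ / 2) (hlam : 0 < lam) (hp : 0 < p) (hz : 0 ≤ z) (hzp : z ≤ p) :
    moc α δ γ lam (p + z) + moc α δ γ lam (p - z) ≤ 2 * moc α δ γ lam p := by
  obtain ⟨m, hm⟩ := exists_moc_le_tangent hα hα2 hδ hγ0 hγ hlam hp
  have h1 := hm (p + z) (by linarith)
  have h2 := hm (p - z) (by linarith)
  linarith

lemma moc_nonneg {α δ γ lam ξ : ℝ} (hα : 0 < α) (hδ : 0 < δ)
    (hγ0 : 0 < γ) (hlam : 0 < lam) (hξ : 0 < ξ) : 0 ≤ moc α δ γ lam ξ := by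
  rcases le_or_gt ξ lam with h | h
  · rw [moc_of_le h, show (-(1:ℝ) - α/2) = -(1 + α/2) by ring, Real.rpow_neg hlam.le,
      mul_assoc (δ / 4), inv_mul_eq_div, ← Real.div_rpow hξ.le hlam.le, mul_assoc, inv_mul_eq_div]
    have ht : 0 ≤ ξ / lam := by positivity
    have ht1 : ξ / lam ≤ 1 := (div_le_one hlam).2 h
    have h1 : (ξ / lam) ^ (1 + α/2) ≤ (ξ / lam) ^ (1:ℝ) :=
      Real.rpow_le_rpow_of_exponent_ge (by positivity) ht1 (by linarith)
    rw [Real.rpow_one] at h1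
    nlinarith
  · rw [moc_of_lt h]
    have := Real.log_nonneg ((one_le_div hlam).2 h.le)
    positivity

/-- A power majorant of `moc`. -/
lemma moc_le_rpow {α δ γ lam K z : ℝ} (hα : 0 < α) (hα2 : α < 2) (hδ : 0 < δ)
    (hγ : γ < δ / 2) (hlam : 0 < lam) (hK1 : 1 ≤ K) (hK : 1 / α ≤ K) (hz : 0 < z) :
    moc α δ γ lam z ≤ K * δ * lam ^ (-(α/2)) * z ^ (α/2) := by
  have e : K * δ * lam ^ (-(α/2)) * z ^ (α/2) = δ * (K * (z / lam) ^ (α/2)) := by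
    rw [Real.rpow_neg hlam.le, Real.div_rpow hz.le hlam.le]; ring
  rw [e]
  set t := z / lam with ht
  have ht0 : 0 < t := by positivity
  rcases le_or_gt z lam with h | h
  · rw [moc_of_le h]
    have ht1 : t ≤ 1 := (div_le_one hlam).2 h
    have h1 : t ^ (1:ℝ) ≤ t ^ (α/2) :=
      Real.rpow_le_rpow_of_exponent_ge ht0 ht1 (by linarith)
    rw [Real.rpow_one] at h1
    have h2 : 0 ≤ δ / 4 * lam ^ (-(1:ℝ) - α/2) * z ^ (1 + α/2) := by positivity
    have h3 : δ * lam⁻¹ * z = δ * t := by rw [ht]; ring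
    have h4 : t ^ (α/2) ≤ K * t ^ (α/2) := le_mul_of_one_le_left (by positivity) hK1
    have := mul_le_mul_of_nonneg_left (h1.trans h4) hδ.le
    linarith
  · rw [moc_of_lt h]
    have ht1 : 1 ≤ t := (one_le_div hlam).2 h.le
    have hl : 0 ≤ Real.log t := Real.log_nonneg ht1
    set u := t ^ (α/2) with hu
    have hu1 : 1 ≤ u := Real.one_le_rpow ht1 (by positivity)
    have h1 : Real.log u ≤ u - 1 := Real.log_le_sub_one_of_pos (by positivity)
    rw [hu, Real.log_rpow ht0, ← hu] at h1
    have h2 : Real.log t / 2 ≤ 1 / α * (u - 1) := by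
      rw [one_div, ← div_eq_inv_mul, le_div_iff₀ hα]; linarith
    have h3 : 1 / α * (u - 1) ≤ K * (u - 1) := mul_le_mul_of_nonneg_right hK (by linarith)
    have h4 : γ * Real.log t ≤ δ / 2 * Real.log t := mul_le_mul_of_nonneg_right hγ.le hl
    have h5 : δ * (3 / 4 + Real.log t / 2) ≤ δ * (K * u) :=
      mul_le_mul_of_nonneg_left (by linarith) hδ.le
    linarith

/-- Second differences of a `C²` function are quadratically small. -/
lemma exists_second_difference_le {f : ℝ → ℝ} (hf : ContDiff ℝ 2 f) (x R : ℝ) :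
    ∃ C, 0 ≤ C ∧ ∀ z, 0 ≤ z → z ≤ R → |2 * f x - f (x + z) - f (x - z)| ≤ C * z ^ 2 := by
  have hf' : ContDiff ℝ 1 (deriv f) := by
    rw [show (2 : WithTop ℕ∞) = 1 + 1 by norm_num, contDiff_succ_iff_deriv] at hf
    exact hf.2.2
  have hd : Differentiable ℝ f := hf.differentiable (by norm_num)
  have hd' : Differentiable ℝ (deriv f) := hf'.differentiable (by norm_num)
  obtain ⟨C, hC⟩ := (isCompact_Icc (a := x - R) (b := x + R)).exists_bound_of_continuousOn
    (hf'.continuous_deriv (by norm_num)).continuousOn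
  have hC' : ∀ t ∈ Icc (x - R) (x + R), ‖deriv (deriv f) t‖ ≤ max C 0 :=
    fun t ht => (hC t ht).trans (le_max_left _ _)
  refine ⟨2 * max C 0, by positivity, fun z hz hzR => ?_⟩
  have hG : ∀ t, HasDerivAt (fun t => f (x + t) + f (x - t))
      (deriv f (x + t) - deriv f (x - t)) t := by
    intro t
    have h1 := (hd (x + t)).hasDerivAt.comp_const_add x t
    have h2 := (hd (x - t)).hasDerivAt.comp_const_sub x t
    exact (h1.add h2).congr_deriv (sub_eq_add_neg _ _).symm
  have key := (convex_Icc 0 z).norm_image_sub_le_of_norm_deriv_le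
    (f := fun t => f (x + t) + f (x - t)) (C := 2 * max C 0 * z) (x := 0) (y := z)
    (fun t _ => (hG t).differentiableAt) ?_ ⟨le_rfl, hz⟩ ⟨hz, le_rfl⟩
  · simp only [Real.norm_eq_abs, add_zero, sub_zero, abs_of_nonneg hz] at key
    rw [abs_sub_comm] at key
    calc _ = |f x + f x - (f (x + z) + f (x - z))| := by ring_nf
      _ ≤ _ := key
      _ = _ := by ring
  · intro t ht
    rw [(hG t).deriv]
    have h1 := (convex_Icc (x - R) (x + R)).norm_image_sub_le_of_norm_deriv_le
      (f := deriv f) (C := max C 0) (x := x - t) (y := x + t) (fun s _ => hd' s) hC'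
      ⟨by linarith [ht.2], by linarith [ht.1, ht.2]⟩ ⟨by linarith [ht.1, ht.2], by linarith [ht.2]⟩
    refine h1.trans ?_
    have h2 : ‖x + t - (x - t)‖ = 2 * t := by
      rw [Real.norm_eq_abs, abs_of_nonneg (by linarith [ht.1])]; ring
    rw [h2]
    nlinarith [le_max_right C 0, ht.2]

lemma A12.nonneg {φ : ℝ → ℝ} {α a₀ c₁ c₂ z : ℝ} (h : A12 φ α a₀ c₁ c₂) (hz : 0 < z)
    (hza : z ≤ a₀) : 0 ≤ φ z := by
  have h1 := h.lower z hz.ne' (by rwa [abs_of_pos hz])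
  have := h.c₁ge
  exact le_trans (by positivity) h1

lemma A12.le_rpow {φ : ℝ → ℝ} {α a₀ c₁ c₂ z : ℝ} (h : A12 φ α a₀ c₁ c₂) (hz : 0 < z)
    (hza : z ≤ a₀) : φ z ≤ c₁ * z ^ (-(1 + α)) := by
  have h1 := h.upper z hz.ne' (by rwa [abs_of_pos hz])
  rwa [abs_of_pos hz] at h1

lemma measurableSet_le_abs (a : ℝ) : MeasurableSet {z : ℝ | a ≤ |z|} :=
  measurableSet_le measurable_const measurable_id.abs

lemma A12.integrableOn_tail {φ : ℝ → ℝ} {α a₀ c₁ c₂ : ℝ} (h : A12 φ α a₀ c₁ c₂) :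
    IntegrableOn φ {z : ℝ | a₀ ≤ |z|} := by
  have h0 := h.tailInt 0 (by norm_num)
  simp only [Nat.cast_zero, Real.rpow_zero, iteratedDeriv_zero, one_mul] at h0
  refine (integrable_norm_iff ?_).1 h0
  refine (h.smooth.continuousOn.mono fun z hz => ?_).aestronglyMeasurable (measurableSet_le_abs a₀)
  rintro rfl
  have := h.a₀pos
  simp at hz
  linarith

lemma A12.integral_tail_le {φ : ℝ → ℝ} {α a₀ c₁ c₂ : ℝ} (h : A12 φ α a₀ c₁ c₂) :
    ∫ z in {z : ℝ | a₀ ≤ |z|}, |φ z| ≤ c₂ := by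
  simpa using h.tailBound 0 (by norm_num)

lemma A12.integrableOn_tail_mul {φ f : ℝ → ℝ} {α a₀ c₁ c₂ M : ℝ} (h : A12 φ α a₀ c₁ c₂)
    (hf : Continuous f) (hosc : ∀ a b, |f a - f b| ≤ M) (x : ℝ) :
    IntegrableOn (fun z => φ z * (f x - f (x - z))) {z : ℝ | a₀ ≤ |z|} :=
  h.integrableOn_tail.mul_bdd
    (by fun_prop : Continuous fun z => f x - f (x - z)).aestronglyMeasurable
    (Eventually.of_forall fun _ => hosc _ _)

lemma A12.integrableOn_core {φ f : ℝ → ℝ} {α a₀ c₁ c₂ : ℝ} (h : A12 φ α a₀ c₁ c₂)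
    (hf : ContDiff ℝ 2 f) (x : ℝ) :
    IntegrableOn (fun z => φ z * (2 * f x - f (x + z) - f (x - z))) (Ioc 0 a₀) := by
  obtain ⟨C, hC0, hC⟩ := exists_second_difference_le hf x a₀
  have hfc := hf.continuous
  have hαlt := h.αlt
  have hdom : IntegrableOn (fun z : ℝ => c₁ * C * z ^ (1 - α)) (Ioc 0 a₀) := by
    have := (intervalIntegral.intervalIntegrable_rpow' (a := 0) (b := a₀) (r := 1 - α)
      (by linarith)).const_mul (c₁ * C)
    rwa [intervalIntegrable_iff_integrableOn_Ioc_of_le h.a₀pos.le] at this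
  refine Integrable.mono' hdom ?_ ?_
  · refine ContinuousOn.aestronglyMeasurable ?_ measurableSet_Ioc
    refine (h.smooth.continuousOn.mono fun z hz => hz.1.ne').mul ?_
    exact (by fun_prop : Continuous fun z => 2 * f x - f (x + z) - f (x - z)).continuousOn
  · filter_upwards [ae_restrict_mem measurableSet_Ioc] with z hz
    have hφ := h.nonneg hz.1 hz.2
    rw [Real.norm_eq_abs, abs_mul, abs_of_nonneg hφ]
    calc φ z * _ ≤ (c₁ * z ^ (-(1 + α))) * (C * z ^ 2) :=
          mul_le_mul (h.le_rpow hz.1 hz.2) (hC z hz.1.le hz.2) (abs_nonneg _)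
            (hφ.trans (h.le_rpow hz.1 hz.2))
      _ = c₁ * C * (z ^ (-(1 + α)) * z ^ (2:ℝ)) := by rw [Real.rpow_two]; ring
      _ = _ := by rw [← Real.rpow_add hz.1]; ring_nf

/-- The truncated integrals defining `levy`, folded onto the positive half-line. -/
lemma A12.truncated_integral_eq {φ f : ℝ → ℝ} {α a₀ c₁ c₂ M : ℝ} (h : A12 φ α a₀ c₁ c₂)
    (hf : Continuous f) (hosc : ∀ a b, |f a - f b| ≤ M) (x : ℝ) {ε : ℝ} (hε : 0 < ε)
    (hεa : ε < a₀) :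
    ∫ w in {w : ℝ | ε ≤ |x - w|}, φ (x - w) * (f x - f w) =
      (∫ z in {z : ℝ | a₀ ≤ |z|}, φ z * (f x - f (x - z))) +
        ∫ z in ε..a₀, φ z * (2 * f x - f (x + z) - f (x - z)) := by
  set k : ℝ → ℝ := fun z => φ z * (f x - f (x - z)) with hk
  have hkc : ContinuousOn k {(0:ℝ)}ᶜ := h.smooth.continuousOn.mul
    (by fun_prop : Continuous fun z => f x - f (x - z)).continuousOn
  have hshift : ∫ w in {w : ℝ | ε ≤ |x - w|}, φ (x - w) * (f x - f w) =
      ∫ z in {z : ℝ | ε ≤ |z|}, k z := by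
    rw [← integral_indicator (measurableSet_le_abs ε),
      ← integral_sub_left_eq_self _ volume x,
      ← integral_indicator (show MeasurableSet {w : ℝ | ε ≤ |x - w|} from
        measurableSet_le measurable_const (measurable_id.const_sub x).abs)]
    congr 1
    ext w
    simp [indicator, hk]
  have hsplit : {z : ℝ | ε ≤ |z|} = {z : ℝ | a₀ ≤ |z|} ∪ (Ico ε a₀ ∪ Ioc (-a₀) (-ε)) := by
    ext z
    simp only [mem_ofPred_eq, mem_union, mem_Ico, mem_Ioc]
    rcases le_total 0 z with hz | hz
    · rw [abs_of_nonneg hz]; grind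
    · rw [abs_of_nonpos hz]; grind
  have hdisj1 : Disjoint {z : ℝ | a₀ ≤ |z|} (Ico ε a₀ ∪ Ioc (-a₀) (-ε)) := by
    rw [Set.disjoint_left]
    intro z hz hz'
    simp only [mem_ofPred_eq, mem_union, mem_Ico, mem_Ioc] at hz hz'
    rcases le_total 0 z with hz0 | hz0
    · rw [abs_of_nonneg hz0] at hz; grind
    · rw [abs_of_nonpos hz0] at hz; grind
  have hdisj2 : Disjoint (Ico ε a₀) (Ioc (-a₀) (-ε)) := by
    rw [Set.disjoint_left]
    intro z hz hz'
    have := hz.1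
    have := hz'.2
    linarith
  have hint1 : IntegrableOn k (Icc ε a₀) :=
    (hkc.mono fun z hz => (hε.trans_le hz.1).ne').integrableOn_Icc
  have hint2 : IntegrableOn k (Icc (-a₀) (-ε)) :=
    (hkc.mono fun z hz => (hz.2.trans_lt (neg_neg_of_pos hε)).ne).integrableOn_Icc
  have hint1' := hint1.mono_set Ico_subset_Icc_self
  have hint2' := hint2.mono_set Ioc_subset_Icc_self
  have hi1 : IntervalIntegrable k volume ε a₀ :=
    (intervalIntegrable_iff_integrableOn_Icc_of_le hεa.le).2 hint1
  have hi2 : IntervalIntegrable (fun z => k (-z)) volume ε a₀ := by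
    refine (ContinuousOn.comp (t := {(0:ℝ)}ᶜ) hkc continuousOn_neg fun z hz => ?_).intervalIntegrable
    rw [uIcc_of_le hεa.le] at hz
    exact (neg_neg_of_pos (hε.trans_le hz.1)).ne
  rw [hshift, hsplit, setIntegral_union hdisj1 (measurableSet_Ico.union measurableSet_Ioc)
    (h.integrableOn_tail_mul hf hosc x) (hint1'.union hint2'),
    setIntegral_union hdisj2 measurableSet_Ioc hint1' hint2', integral_Ico_eq_integral_Ioc,
    ← intervalIntegral.integral_of_le hεa.le,
    ← intervalIntegral.integral_of_le (neg_le_neg hεa.le),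
    ← intervalIntegral.integral_comp_neg, ← intervalIntegral.integral_add hi1 hi2]
  congr 2
  ext z
  simp only [hk, h.even, sub_neg_eq_add]
  ring

/-- Convergence of the principal value. -/
lemma A12.tendsto_levy {φ f : ℝ → ℝ} {α a₀ c₁ c₂ M : ℝ} (h : A12 φ α a₀ c₁ c₂)
    (hf : ContDiff ℝ 2 f) (hosc : ∀ a b, |f a - f b| ≤ M) (x : ℝ) :
    Tendsto (fun ε => ∫ w in {w : ℝ | ε ≤ |x - w|}, φ (x - w) * (f x - f w)) (𝓝[>] 0)
      (𝓝 ((∫ z in {z : ℝ | a₀ ≤ |z|}, φ z * (f x - f (x - z))) +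
        ∫ z in (0:ℝ)..a₀, φ z * (2 * f x - f (x + z) - f (x - z)))) := by
  have ha := h.a₀pos
  have hcore := h.integrableOn_core hf x
  rw [← integrableOn_Icc_iff_integrableOn_Ioc, ← uIcc_of_le ha.le] at hcore
  have hcont := intervalIntegral.continuousOn_primitive_interval_left hcore 0 left_mem_uIcc
  have hlim := hcont.tendsto.mono_left (nhdsWithin_mono 0
    (show Ioc 0 a₀ ⊆ uIcc 0 a₀ by rw [uIcc_of_le ha.le]; exact Ioc_subset_Icc_self))
  rw [nhdsWithin_Ioc_eq_nhdsGT ha] at hlim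
  refine (tendsto_const_nhds.add hlim).congr' ?_
  filter_upwards [Ioo_mem_nhdsGT ha] with ε hε
  exact (h.truncated_integral_eq hf.continuous hosc x hε.1 hε.2).symm

lemma A12.levy_eq {φ f : ℝ → ℝ} {α a₀ c₁ c₂ M : ℝ} (h : A12 φ α a₀ c₁ c₂)
    (hf : ContDiff ℝ 2 f) (hosc : ∀ a b, |f a - f b| ≤ M) (x : ℝ) :
    levy φ f x = (∫ z in {z : ℝ | a₀ ≤ |z|}, φ z * (f x - f (x - z))) +
        ∫ z in (0:ℝ)..a₀, φ z * (2 * f x - f (x + z) - f (x - z)) :=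
  (h.tendsto_levy hf hosc x).limUnder_eq

lemma A12.levy_neg {φ f : ℝ → ℝ} {α a₀ c₁ c₂ M : ℝ} (h : A12 φ α a₀ c₁ c₂)
    (hf : ContDiff ℝ 2 f) (hosc : ∀ a b, |f a - f b| ≤ M) (x : ℝ) :
    levy φ (fun t => -f t) x = -levy φ f x := by
  refine Tendsto.limUnder_eq ?_
  rw [h.levy_eq hf hosc x]
  refine (h.tendsto_levy hf hosc x).neg.congr fun ε => ?_
  rw [← integral_neg]
  congr 1
  ext w
  ring

/-- Upper bound for `-levy φ f x` from a one-sided bound on the second differences of `f` at `x`. -/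
lemma A12.neg_levy_le {φ f : ℝ → ℝ} {α a₀ c₁ c₂ M A ξ : ℝ} (h : A12 φ α a₀ c₁ c₂)
    (hf : ContDiff ℝ 2 f) (hosc : ∀ a b, |f a - f b| ≤ M) (x : ℝ) (hξ : 0 < ξ)
    (hA : 0 ≤ A)
    (hnear : ∀ z, 0 < z → z ≤ ξ → f (x + z) + f (x - z) ≤ 2 * f x)
    (hfar : ∀ z, ξ < z → f (x + z) + f (x - z) - 2 * f x ≤ 2 * (A * z ^ (α/2))) :
    -levy φ f x ≤ c₂ * M + 4 * c₁ / α * A * ξ ^ (-(α/2)) := by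
  have hα := h.αpos
  have hc₁ : 0 < c₁ := one_pos.trans_le h.c₁ge
  have hM : 0 ≤ M := (abs_nonneg _).trans (hosc 0 0)
  rw [h.levy_eq hf hosc x, neg_add]
  refine add_le_add ?_ ?_
  · rw [← integral_neg]
    calc ∫ z in {z : ℝ | a₀ ≤ |z|}, -(φ z * (f x - f (x - z)))
        ≤ ∫ z in {z : ℝ | a₀ ≤ |z|}, |φ z| * M := by
          refine integral_mono (h.integrableOn_tail_mul hf.continuous hosc x).neg
            (h.integrableOn_tail.abs.mul_const M) fun z => ?_
          refine (neg_le_abs _).trans ?_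
          rw [abs_mul]
          exact mul_le_mul_of_nonneg_left (hosc _ _) (abs_nonneg _)
      _ = (∫ z in {z : ℝ | a₀ ≤ |z|}, |φ z|) * M := integral_mul_const _ _
      _ ≤ c₂ * M := mul_le_mul_of_nonneg_right h.integral_tail_le hM
  · set g : ℝ → ℝ := fun z => 2 * c₁ * A * z ^ (-1 - α/2) with hg
    have hgint : IntegrableOn g (Ioi ξ) :=
      (integrableOn_Ioi_rpow_of_lt (by linarith) hξ).const_mul _
    have hgind : Integrable ((Ioi ξ).indicator g) := hgint.integrable_indicator measurableSet_Ioi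
    have hind0 : 0 ≤ (Ioi ξ).indicator g := indicator_nonneg fun z hz => by
      have hz0 : 0 < z := hξ.trans hz
      simp only [hg]
      positivity
    rw [intervalIntegral.integral_of_le h.a₀pos.le, ← integral_neg]
    calc ∫ z in Ioc 0 a₀, -(φ z * (2 * f x - f (x + z) - f (x - z)))
        ≤ ∫ z in Ioc 0 a₀, (Ioi ξ).indicator g z := by
          refine setIntegral_mono_on (h.integrableOn_core hf x).neg hgind.integrableOn
            measurableSet_Ioc fun z hz => ?_
          have hφ := h.nonneg hz.1 hz.2
          rcases le_or_gt z ξ with hzξ | hzξ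
          · rw [indicator_of_notMem (by simpa using hzξ)]
            have := mul_nonneg hφ (sub_nonneg.2 (hnear z hz.1 hzξ))
            linarith
          · rw [indicator_of_mem (mem_Ioi.2 hzξ)]
            have hz0 := hz.1
            calc -(φ z * (2 * f x - f (x + z) - f (x - z)))
                = φ z * (f (x + z) + f (x - z) - 2 * f x) := by ring
              _ ≤ φ z * (2 * (A * z ^ (α/2))) := mul_le_mul_of_nonneg_left (hfar z hzξ) hφ
              _ ≤ c₁ * z ^ (-(1 + α)) * (2 * (A * z ^ (α/2))) :=
                  mul_le_mul_of_nonneg_right (h.le_rpow hz.1 hz.2) (by positivity)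
              _ = 2 * c₁ * A * (z ^ (-(1 + α)) * z ^ (α/2)) := by ring
              _ = g z := by rw [← Real.rpow_add hz0]; simp only [hg]; ring_nf
      _ ≤ ∫ z, (Ioi ξ).indicator g z :=
          setIntegral_le_integral hgind (Eventually.of_forall hind0)
      _ = ∫ z in Ioi ξ, g z := integral_indicator measurableSet_Ioi
      _ = 4 * c₁ / α * A * ξ ^ (-(α/2)) := by
          simp only [hg]
          rw [integral_const_mul, integral_Ioi_rpow_of_lt (by linarith) hξ,
            show -1 - α/2 + 1 = -(α/2) by ring]
          field_simp
          ring

/-- Symmetric second differences at a breakthrough point of the modulus `moc`. -/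
lemma add_sub_two_mul_le_moc {α δ γ lam ξ x y z : ℝ} {f : ℝ → ℝ}
    (hobeys : ∀ a b : ℝ, f a - f b ≤ moc α δ γ lam |a - b|) (hξ : ξ = |x - y|)
    (hscen : f x - f y = moc α δ γ lam ξ) (hξ0 : 0 < ξ) (hz : 0 < z) :
    f (x + z) + f (x - z) - 2 * f x ≤
      moc α δ γ lam (ξ + z) + moc α δ γ lam |ξ - z| - 2 * moc α δ γ lam ξ := by
  have h1 := hobeys (x + z) y
  have h2 := hobeys (x - z) y
  rcases le_total 0 (x - y) with hs | hs
  · rw [abs_of_nonneg hs] at hξ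
    rw [show x + z - y = ξ + z by rw [hξ]; ring, abs_of_pos (by positivity)] at h1
    rw [show x - z - y = ξ - z by rw [hξ]; ring] at h2
    linarith
  · rw [abs_of_nonpos hs] at hξ
    rw [show x + z - y = -(ξ - z) by rw [hξ]; ring, abs_neg] at h1
    rw [show x - z - y = -(ξ + z) by rw [hξ]; ring, abs_neg, abs_of_pos (by positivity)] at h2
    linarith

lemma exists_div_le_Cbar {α : ℝ} (hα : 0 < α) :
    ∃ K, 1 ≤ K ∧ 1 / α ≤ K ∧ K / α ≤ Cbar α := by
  unfold Cbar
  split_ifs with h1 h2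
  · refine ⟨1 / α, (one_le_div hα).2 h1.le, le_rfl, ?_⟩
    rw [div_div, ← sq]
    refine one_div_le_one_div_of_le (mul_pos (by positivity) (by linarith)) ?_
    nlinarith [sq_nonneg α]
  · subst h2
    exact ⟨1, le_rfl, by norm_num, by norm_num⟩
  · have h3 : 1 < α := lt_of_le_of_ne (not_lt.1 h1) (Ne.symm h2)
    have h4 : 1 / α ≤ 1 := (div_le_one hα).2 h3.le
    have h5 : 0 < 1 / (α - 1) := one_div_pos.2 (by linarith)
    exact ⟨1, le_rfl, h4, by linarith⟩

/-- The bounds on `-levy φ f x` at a breakthrough point, for `f` of either sign. -/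
lemma A12.neg_levy_le_of_breakthrough {φ f : ℝ → ℝ} {α a₀ c₁ c₂ δ γ lam M x y ξ : ℝ}
    (h : A12 φ α a₀ c₁ c₂) (hδ : 0 < δ) (hγ0 : 0 < γ) (hγ : γ < δ / 2) (hlam : 0 < lam)
    (hf : ContDiff ℝ 2 f) (hosc : ∀ a b, |f a - f b| ≤ M)
    (hobeys : ∀ a b : ℝ, f a - f b ≤ moc α δ γ lam |a - b|) (hξ0 : 0 < ξ) (hξ : ξ = |x - y|)
    (hscen : f x - f y = moc α δ γ lam ξ) :
    (ξ ≤ lam →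
      -levy φ f x ≤ c₂ * M + 4 * c₁ * Cbar α * δ * lam ^ (-(α/2)) * ξ ^ (-(α/2))) ∧
    (lam < ξ → -levy φ f x ≤ c₂ * M + 12 * c₁ / α^2 * γ * ξ ^ (-α)) := by
  have hα := h.αpos
  have hα2 := h.αlt
  have hc₁ : 0 < c₁ := one_pos.trans_le h.c₁ge
  have hnear : ∀ z, 0 < z → z ≤ ξ → f (x + z) + f (x - z) ≤ 2 * f x := by
    intro z hz hzξ
    have h1 := add_sub_two_mul_le_moc hobeys hξ hscen hξ0 hz
    have h2 := moc_add_moc_sub_le hα hα2 hδ hγ0 hγ hlam hξ0 hz.le hzξ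
    rw [abs_of_nonneg (sub_nonneg.2 hzξ)] at h1
    linarith
  have hfar : ∀ z, ξ < z → f (x + z) + f (x - z) - 2 * f x ≤
      2 * (moc α δ γ lam z - moc α δ γ lam ξ) := by
    intro z hzξ
    have hz := hξ0.trans hzξ
    have h1 := add_sub_two_mul_le_moc hobeys hξ hscen hξ0 hz
    have h2 := moc_add_moc_sub_le hα hα2 hδ hγ0 hγ hlam hz hξ0.le hzξ.le
    rw [abs_of_neg (sub_neg.2 hzξ), neg_sub, add_comm ξ z] at h1
    linarith
  constructor
  · intro _
    obtain ⟨K, hK1, hKα, hKC⟩ := exists_div_le_Cbar hα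
    have hK0 : 0 < K := by linarith
    refine (h.neg_levy_le (A := K * δ * lam ^ (-(α/2))) hf hosc x hξ0 (by positivity) hnear
      fun z hz => (hfar z hz).trans ?_).trans ?_
    · have h1 := moc_le_rpow hα hα2 hδ hγ hlam hK1 hKα (hξ0.trans hz)
      have h2 := moc_nonneg hα hδ hγ0 hlam hξ0
      linarith
    · have : K / α * (4 * c₁ * δ * lam ^ (-(α/2)) * ξ ^ (-(α/2))) ≤
          Cbar α * (4 * c₁ * δ * lam ^ (-(α/2)) * ξ ^ (-(α/2))) :=
        mul_le_mul_of_nonneg_right hKC (by positivity)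
      refine add_le_add le_rfl (le_trans (le_of_eq ?_) (this.trans (le_of_eq ?_))) <;> ring
  · intro hlt
    refine (h.neg_levy_le (A := 2 / α * γ * ξ ^ (-(α/2))) hf hosc x hξ0 (by positivity) hnear
      fun z hz => (hfar z hz).trans ?_).trans ?_
    · have hz0 := hξ0.trans hz
      have h1 := Real.log_le_rpow_div (x := z / ξ) (by positivity) (half_pos hα)
      rw [Real.log_div hz0.ne' hξ0.ne', Real.div_rpow hz0.le hξ0.le] at h1
      rw [moc_of_lt hlt, moc_of_lt (hlt.trans hz), Real.log_div hz0.ne' hlam.ne',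
        Real.log_div hξ0.ne' hlam.ne', Real.rpow_neg hξ0.le]
      have h2 := mul_le_mul_of_nonneg_left h1 hγ0.le
      have h3 : γ * (z ^ (α/2) / ξ ^ (α/2) / (α/2)) =
          2 / α * γ * (ξ ^ (α/2))⁻¹ * z ^ (α/2) := by field_simp
      linarith
    · have h1 : ξ ^ (-α) = ξ ^ (-(α/2)) * ξ ^ (-(α/2)) := by
        rw [← Real.rpow_add hξ0]; ring_nf
      have h2 : 4 * c₁ / α * (2 / α * γ * ξ ^ (-(α/2))) * ξ ^ (-(α/2)) =
          8 * (c₁ / α^2 * γ * ξ ^ (-α)) := by rw [h1]; field_simp; ring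
      have h3 : 0 ≤ c₁ / α^2 * γ * ξ ^ (-α) := by positivity
      have h4 : 12 * c₁ / α^2 * γ * ξ ^ (-α) = 12 * (c₁ / α^2 * γ * ξ ^ (-α)) := by ring
      rw [h2, h4]
      linarith

/-- (Explicit one-sided bounds at a breakthrough pair, for the concrete
modulus.) Both `−𝓛ρ(x)` and `𝓛ρ(y)` are at most
`2c₃M₁ + 4c₁ C̄_α δ λ^{-α/2} ξ^{-α/2}` when `ξ ≤ λ`, and at most
`2c₃M₁ + (12c₁/α²) γ ξ^{-α}` when `λ < ξ ≤ r₀/2`. -/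
theorem stmt17 (φ : ℝ → ℝ) (α a₀ c₁ c₂ : ℝ) (h : A12 φ α a₀ c₁ c₂)
    (δ γ lam : ℝ) (hδ : 0 < δ) (hγ0 : 0 < γ) (hγ : γ < δ / 2) (hlam : 0 < lam)
    (M₁ : ℝ)
    (ρ : ℝ → ℝ) (hsm : ContDiff ℝ (⊤ : ℕ∞) ρ) (hper : ∀ x, ρ (x + 1) = ρ x)
    (hρ0 : ∀ x, 0 ≤ ρ x) (hρM : ∀ x, ρ x ≤ M₁)
    (hobeys : ∀ a b : ℝ, a ≠ b → |ρ a - ρ b| ≤ moc α δ γ lam |a - b|)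
    (x y ξ : ℝ) (hxy : x ≠ y) (hξ : ξ = |x - y|)
    (hξr : ξ ≤ min a₀ ((6 * c₁ * c₂) ^ (-(1 + α)⁻¹)) / 2)
    (hscen : ρ x - ρ y = moc α δ γ lam ξ) :
    let c₃ := c₁ * (min a₀ ((6 * c₁ * c₂) ^ (-(1 + α)⁻¹))) ^ (-(1 + α)) + c₂ * (1 + a₀⁻¹);
    (ξ ≤ lam →
      -(levy φ ρ x) ≤ 2 * c₃ * M₁ + 4 * c₁ * Cbar α * δ * lam ^ (-(α/2)) * ξ ^ (-(α/2)) ∧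
      levy φ ρ y ≤ 2 * c₃ * M₁ + 4 * c₁ * Cbar α * δ * lam ^ (-(α/2)) * ξ ^ (-(α/2))) ∧
    (lam < ξ →
      -(levy φ ρ x) ≤ 2 * c₃ * M₁ + 12 * c₁ / α^2 * γ * ξ ^ (-α) ∧
      levy φ ρ y ≤ 2 * c₃ * M₁ + 12 * c₁ / α^2 * γ * ξ ^ (-α)) := by
  intro c₃
  have hα := h.αpos
  have ha := h.a₀pos
  have hc₂ := h.c₂pos
  have hc₁ : 0 < c₁ := one_pos.trans_le h.c₁ge
  have hM : 0 ≤ M₁ := (hρ0 0).trans (hρM 0)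
  have hξ0 : 0 < ξ := hξ ▸ abs_pos.2 (sub_ne_zero.2 hxy)
  have hc₃ : c₂ ≤ c₃ := by
    have h1 : 0 ≤ c₁ * (min a₀ ((6 * c₁ * c₂) ^ (-(1 + α)⁻¹))) ^ (-(1 + α)) := by positivity
    have h2 : 0 ≤ c₂ * a₀⁻¹ := by positivity
    simp only [c₃]
    linarith
  have htail : c₂ * M₁ ≤ 2 * c₃ * M₁ :=
    mul_le_mul_of_nonneg_right (by linarith) hM
  have hsm2 : ContDiff ℝ 2 ρ := contDiff_infty.1 hsm 2
  have hosc : ∀ a b, |ρ a - ρ b| ≤ M₁ := fun a b =>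
    abs_le.2 ⟨by linarith [hρ0 a, hρM b], by linarith [hρM a, hρ0 b]⟩
  have hobeys' : ∀ a b, |ρ a - ρ b| ≤ moc α δ γ lam |a - b| := by
    intro a b
    rcases eq_or_ne a b with rfl | hab
    · simp [moc_zero hα hlam]
    · exact hobeys a b hab
  have hx := h.neg_levy_le_of_breakthrough hδ hγ0 hγ hlam hsm2 hosc
    (fun a b => (le_abs_self _).trans (hobeys' a b)) hξ0 hξ hscen
  have hy := h.neg_levy_le_of_breakthrough (f := fun t => -ρ t) (x := y) (y := x) (M := M₁)
    hδ hγ0 hγ hlam hsm2.neg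
    (fun a b => by rw [show -ρ a - -ρ b = -(ρ a - ρ b) by ring, abs_neg]; exact hosc a b)
    (fun a b => by
      rw [show -ρ a - -ρ b = -(ρ a - ρ b) by ring]
      exact (neg_le_abs _).trans (hobeys' a b))
    hξ0 (by rw [hξ, abs_sub_comm]) (by rw [← hscen]; ring)
  rw [h.levy_neg hsm2 hosc y, neg_neg] at hy
  refine ⟨fun hle => ⟨(hx.1 hle).trans ?_, (hy.1 hle).trans ?_⟩,
    fun hlt => ⟨(hx.2 hlt).trans ?_, (hy.2 hlt).trans ?_⟩⟩ <;> linarith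
end
end

section
/- Let φ satisfy assumptions (A1)–(A2) with α ∈ (1,2) and a₀ ≤ 1/2. Fix δ > 0, 0 < γ < δ/2, and 0 < λ ≤ r₀, and let ω be the modulus of continuity ω(ξ) := δλ^{−1}ξ − (δ/4)λ^{−1−α/2}ξ^{1+α/2} for 0 < ξ ≤ λ and ω(ξ) := (3/4)δ + γ log(ξ/λ) for ξ > λ. Let ρ : ℝ → ℝ be smooth and 1-periodic, and suppose its derivative ρ′ satisfies ‖ρ′‖_{L^∞} ≤ M₂ and |ρ′(a) − ρ′(b)| ≤ ω(|a−b|) for all a, b. Then for every x̃ ∈ ℝ, |𝓛ρ(x̃)| ≤ (4c₁/((α−1)²(2−α))) δ λ^{−(α−1)} + (c₃/2) M₂. -/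
open Real MeasureTheory Filter Set Topology

noncomputable section

/-- The modulus lies below its tangent line at the origin. -/
lemma moc_le_linear {α δ γ lam ξ : ℝ} (hδ : 0 < δ) (hγ0 : 0 < γ) (hγ : γ < δ / 2)
    (hlam : 0 < lam) (hξ : 0 < ξ) : moc α δ γ lam ξ ≤ δ * (ξ / lam) := by
  unfold moc
  split_ifs with hle
  · have : 0 ≤ δ / 4 * lam ^ (-(1:ℝ) - α/2) * ξ ^ (1 + α/2) := by positivity
    have e : δ * lam⁻¹ * ξ = δ * (ξ / lam) := by ring
    linarith
  · have h1 : 1 < ξ / lam := by rw [lt_div_iff₀ hlam]; linarith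
    have h2 := Real.log_le_sub_one_of_pos (zero_lt_one.trans h1)
    nlinarith [mul_le_mul_of_nonneg_left h2 hγ0.le]

/-- A power bound for the modulus, with small exponent `a / 2`. -/
lemma moc_le_rpow_s19 {α δ γ lam ξ a : ℝ} (hδ : 0 < δ) (hγ0 : 0 < γ) (hγ : γ < δ / 2)
    (hlam : 0 < lam) (hξ : 0 < ξ) (ha0 : 0 < a) (ha1 : a < 1) :
    moc α δ γ lam ξ ≤ δ * (7 / (4 * a)) * (ξ / lam) ^ (a / 2) := by
  have h74 : 3 / 4 + 1 / a ≤ 7 / (4 * a) := by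
    rw [div_add_div _ _ (by norm_num) ha0.ne']
    gcongr
    linarith
  rcases le_or_gt ξ lam with hle | hgt
  · have hq : ξ / lam ≤ 1 := (div_le_one hlam).2 hle
    have hq0 : 0 < ξ / lam := by positivity
    have h1 : ξ / lam ≤ (ξ / lam) ^ (a / 2) := by
      simpa using Real.rpow_le_rpow_of_exponent_ge hq0 hq (by linarith : a / 2 ≤ 1)
    have h2 : 1 ≤ 7 / (4 * a) := by rw [le_div_iff₀ (by positivity)]; linarith
    calc moc α δ γ lam ξ ≤ δ * (ξ / lam) := moc_le_linear hδ hγ0 hγ hlam hξ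
      _ ≤ δ * 1 * (ξ / lam) ^ (a / 2) := by rw [mul_one]; gcongr
      _ ≤ _ := by gcongr
  · have h1 : 1 < ξ / lam := by rw [lt_div_iff₀ hlam]; linarith
    have hP : 1 ≤ (ξ / lam) ^ (a / 2) := Real.one_le_rpow h1.le (by positivity)
    have hlog := Real.log_le_rpow_div (zero_lt_one.trans h1).le (half_pos ha0)
    unfold moc
    rw [if_neg (not_le.2 hgt)]
    set P := (ξ / lam) ^ (a / 2)
    have hP0 : 0 ≤ P / (a / 2) := by positivity
    calc 3 * δ / 4 + γ * Real.log (ξ / lam) ≤ 3 * δ / 4 * P + δ / 2 * (P / (a / 2)) := by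
          refine add_le_add (le_mul_of_one_le_right (by positivity) hP) ?_
          exact (mul_le_mul_of_nonneg_left hlog hγ0.le).trans
            (mul_le_mul_of_nonneg_right hγ.le hP0)
      _ = δ * (3 / 4 + 1 / a) * P := by field_simp
      _ ≤ _ := by gcongr

/-- The symmetric second difference is controlled by the oscillation of the derivative. -/
lemma abs_second_diff_le {ρ : ℝ → ℝ} (hd : Differentiable ℝ ρ) {C x z : ℝ}
    (hz : 0 ≤ z) (hC0 : 0 ≤ C)
    (hC : ∀ s, 0 < s → s ≤ z → |deriv ρ (x - s) - deriv ρ (x + s)| ≤ C) :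
    |2 * ρ x - ρ (x - z) - ρ (x + z)| ≤ C * z := by
  have key := norm_image_sub_le_of_norm_deriv_le_segment' (a := 0) (b := z)
    (f := fun s => 2 * ρ x - ρ (x - s) - ρ (x + s))
    (f' := fun s => deriv ρ (x - s) - deriv ρ (x + s)) (C := C) ?_ ?_ z ⟨hz, le_rfl⟩
  · have e : 2 * ρ x - ρ x - ρ x = 0 := by ring
    simpa [e] using key
  · intro s _
    have h1 : HasDerivAt (fun s => ρ (x - s)) (-deriv ρ (x - s)) s := by
      simpa using (hd (x - s)).hasDerivAt.comp_const_sub x s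
    have h2 : HasDerivAt (fun s => ρ (x + s)) (deriv ρ (x + s)) s := by
      simpa using (hd (x + s)).hasDerivAt.comp_const_add x s
    have h3 := ((hasDerivAt_const s (2 * ρ x)).sub h1).sub h2
    rw [zero_sub, neg_neg] at h3
    exact h3.hasDerivWithinAt
  · intro s hs
    rcases hs.1.eq_or_lt with rfl | h0
    · simpa using hC0
    · exact hC s h0 hs.2.le

/-- A `1`-periodic function oscillates by at most half its Lipschitz constant. -/
lemma abs_sub_le_half_of_periodic {ρ : ℝ → ℝ} (hd : Differentiable ℝ ρ)
    (hper : Function.Periodic ρ 1) {M : ℝ} (hM : ∀ x, |deriv ρ x| ≤ M) (x y : ℝ) :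
    |ρ x - ρ y| ≤ M / 2 := by
  have hM0 : 0 ≤ M := (abs_nonneg _).trans (hM 0)
  have h1 : ρ (x - round (x - y)) = ρ x := by
    simpa using hper.sub_int_mul_eq (x := x) (round (x - y))
  have h2 := Convex.norm_image_sub_le_of_norm_deriv_le (f := ρ) (s := univ) (C := M)
    (fun z _ => hd z) (fun z _ => hM z) convex_univ (mem_univ y)
    (mem_univ (x - round (x - y)))
  rw [h1, Real.norm_eq_abs, Real.norm_eq_abs] at h2
  have h3 := abs_sub_round (x - y)
  rw [sub_right_comm] at h3
  calc _ ≤ M * |x - round (x - y) - y| := h2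
    _ ≤ M * (1 / 2) := by gcongr
    _ = M / 2 := by ring

/-- Truncated integrals away from `0`, written on the half line. -/
lemma setIntegral_abs_ge_eq {f : ℝ → ℝ} {ε : ℝ} (hε : 0 < ε) (h1 : IntegrableOn f (Ioi ε))
    (h2 : IntegrableOn (fun z => f (-z)) (Ioi ε)) :
    ∫ z in {z : ℝ | ε ≤ |z|}, f z = ∫ z in Ioi ε, (f z + f (-z)) := by
  have hset : {z : ℝ | ε ≤ |z|} = Iic (-ε) ∪ Ici ε := by
    ext z
    simp only [mem_ofPred_eq, le_abs, mem_union, mem_Iic, mem_Ici]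
    constructor <;> rintro (h | h)
    · exact Or.inr h
    · exact Or.inl (by linarith)
    · exact Or.inr (by linarith)
    · exact Or.inl h
  have h2' : IntegrableOn f (Iic (-ε)) := by
    have := (integrableOn_Ici_iff_integrableOn_Ioi (by simp)).2 h2
    rw [← neg_neg ε] at this
    simpa using this.comp_neg_Iic
  have hneg : ∫ z in Iic (-ε), f z = ∫ z in Ioi ε, f (-z) := by
    simp
  rw [hset, setIntegral_union (Set.disjoint_left.2 fun z hz hz' => by
      simp only [mem_Iic, mem_Ici] at hz hz'; linarith) measurableSet_Ici h2'
      (integrableOn_Ici_iff_integrableOn_Ioi (by simp) |>.2 h1), hneg, integral_Ici_eq_integral_Ioi,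
    integral_add h1 h2, add_comm]

namespace A12

variable {φ : ℝ → ℝ} {α a₀ c₁ c₂ : ℝ}

lemma continuousOn (h : A12 φ α a₀ c₁ c₂) : ContinuousOn φ {(0:ℝ)}ᶜ := h.smooth.continuousOn

lemma integrableOn_tail_s19 (h : A12 φ α a₀ c₁ c₂) : IntegrableOn φ {x : ℝ | a₀ ≤ |x|} := by
  have h0 := h.tailInt 0 (by norm_num)
  simp only [Nat.cast_zero, Real.rpow_zero, one_mul, iteratedDeriv_zero] at h0
  have hm : MeasurableSet {x : ℝ | a₀ ≤ |x|} := measurableSet_le measurable_const measurable_abs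
  refine (integrable_norm_iff (ContinuousOn.aestronglyMeasurable
    (h.continuousOn.mono fun x hx => ?_) hm)).1 h0
  rintro rfl
  simp only [mem_ofPred_eq, abs_zero] at hx
  exact absurd h.a₀pos (not_lt.2 hx)

lemma integrableOn_Ioi_a₀ (h : A12 φ α a₀ c₁ c₂) : IntegrableOn φ (Ioi a₀) :=
  h.integrableOn_tail_s19.mono_set fun _ hx => (mem_Ioi.1 hx).le.trans (le_abs_self _)

lemma integrableOn_Ioi (h : A12 φ α a₀ c₁ c₂) {ε : ℝ} (hε : 0 < ε) : IntegrableOn φ (Ioi ε) := by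
  have h1 : IntegrableOn φ (Icc ε a₀) :=
    (h.continuousOn.mono fun x hx => (hε.trans_le hx.1).ne').integrableOn_Icc
  refine (h1.union h.integrableOn_Ioi_a₀).mono_set fun x hx => ?_
  rcases le_or_gt x a₀ with h' | h'
  · exact Or.inl ⟨le_of_lt hx, h'⟩
  · exact Or.inr h'

lemma integral_abs_Ioi_le (h : A12 φ α a₀ c₁ c₂) : ∫ z in Ioi a₀, |φ z| ≤ c₂ / 2 := by
  have h0 := h.tailBound 0 (by norm_num)
  simp only [Nat.cast_zero, Real.rpow_zero, one_mul, iteratedDeriv_zero] at h0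
  have hi : IntegrableOn (fun z => |φ z|) (Ioi a₀) := h.integrableOn_Ioi_a₀.abs
  rw [setIntegral_abs_ge_eq h.a₀pos hi (by simp only [h.even]; exact hi)] at h0
  simp only [h.even, ← two_mul] at h0
  rw [integral_const_mul] at h0
  linarith

lemma nonneg_of_le (h : A12 φ α a₀ c₁ c₂) {z : ℝ} (hz : 0 < z) (hza : z ≤ a₀) : 0 ≤ φ z := by
  have := h.c₁ge
  refine le_trans ?_ (h.lower z hz.ne' (by rwa [abs_of_pos hz]))
  positivity

lemma le_rpow_s19 (h : A12 φ α a₀ c₁ c₂) {z : ℝ} (hz : 0 < z) (hza : z ≤ a₀) :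
    |φ z| ≤ c₁ * z ^ (-(1 + α)) := by
  rw [abs_of_nonneg (h.nonneg_of_le hz hza)]
  simpa only [abs_of_pos hz] using h.upper z hz.ne' (by rwa [abs_of_pos hz])

/-- If the symmetrized integrand is integrable, the principal value exists and is its integral. -/
lemma levy_eq_s19 (h : A12 φ α a₀ c₁ c₂) {f : ℝ → ℝ} (hf : Continuous f) {C : ℝ}
    (hC : ∀ x y, |f x - f y| ≤ C) {x : ℝ}
    (hint : IntegrableOn (fun z => φ z * (2 * f x - f (x - z) - f (x + z))) (Ioi 0)) :
    levy φ f x = ∫ z in Ioi 0, φ z * (2 * f x - f (x - z) - f (x + z)) := by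
  refine Tendsto.limUnder_eq ?_
  have hlim : Tendsto (fun ε : ℝ => ε) (𝓝[>] 0) (𝓝 0) := tendsto_id.mono_left nhdsWithin_le_nhds
  have hT := (aecover_Ioi_of_Ioi (μ := volume) hlim).integral_tendsto_of_countably_generated hint
  refine hT.congr' ?_
  filter_upwards [self_mem_nhdsWithin] with ε hε
  have hε : 0 < ε := hε
  have hφ := h.integrableOn_Ioi hε
  have h1 : IntegrableOn (fun z => φ z * (f x - f (x - z))) (Ioi ε) :=
    hφ.mul_bdd (by fun_prop) (Eventually.of_forall fun z => hC x (x - z))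
  have h2 : IntegrableOn (fun z => φ (-z) * (f x - f (x - -z))) (Ioi ε) := by
    simp only [h.even]
    exact hφ.mul_bdd (by fun_prop) (Eventually.of_forall fun z => hC x (x - -z))
  have hm : MeasurableSet {z : ℝ | ε ≤ |z|} := measurableSet_le measurable_const measurable_abs
  have hm' : MeasurableSet {y : ℝ | ε ≤ |x - y|} :=
    measurableSet_le measurable_const (by fun_prop)
  have hshift : ∫ y in {y : ℝ | ε ≤ |x - y|}, φ (x - y) * (f x - f y)
      = ∫ z in {z : ℝ | ε ≤ |z|}, φ z * (f x - f (x - z)) := by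
    rw [← integral_indicator hm, ← integral_indicator hm', ← integral_sub_left_eq_self _ volume x]
    congr 1
    ext y
    simp [indicator]
  rw [hshift, setIntegral_abs_ge_eq hε h1 h2, Measure.restrict_restrict measurableSet_Ioi,
    inter_eq_left.2 (Ioi_subset_Ioi hε.le)]
  congr 1
  ext z
  rw [h.even, sub_neg_eq_add]
  ring

end A12

/-- `2 ^ t ≤ 1 + t` on `[0, 1]`. -/
lemma two_rpow_le_one_add {t : ℝ} (h0 : 0 ≤ t) (h1 : t ≤ 1) : (2:ℝ) ^ t ≤ 1 + t := by
  have := rpow_one_add_le_one_add_mul_self (s := 1) (by norm_num) h0 h1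
  norm_num at this
  exact this

/-- Integral over `(0, b]` of a function dominated near `0` and near `b` by two powers. -/
lemma integral_Ioc_bound_of_rpow {g : ℝ → ℝ} {b lam A B p q : ℝ} (hlam : 0 < lam) (hb : lam ≤ b)
    (hB0 : 0 ≤ B) (hp : -1 < p) (hq : q < -1)
    (hmeas : AEStronglyMeasurable g (volume.restrict (Ioc 0 b)))
    (hA : ∀ z, 0 < z → z ≤ b → |g z| ≤ A * z ^ p)
    (hB : ∀ z, 0 < z → z ≤ b → |g z| ≤ B * z ^ q) :
    IntegrableOn g (Ioc 0 b) ∧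
      |∫ z in Ioc 0 b, g z| ≤ A * (lam ^ (p + 1) / (p + 1)) + B * (-lam ^ (q + 1) / (q + 1)) := by
  have hpow (c : ℝ) (hc : 0 ≤ c) : IntegrableOn (fun z : ℝ => A * z ^ p) (Ioc 0 c) :=
    ((intervalIntegrable_iff_integrableOn_Ioc_of_le hc).1
      (intervalIntegral.intervalIntegrable_rpow' hp)).const_mul A
  have hqi : IntegrableOn (fun z : ℝ => B * z ^ q) (Ioi lam) :=
    (integrableOn_Ioi_rpow_of_lt hq hlam).const_mul B
  have hqi' : IntegrableOn (fun z : ℝ => B * z ^ q) (Ioc lam b) :=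
    hqi.mono_set Ioc_subset_Ioi_self
  have hint : IntegrableOn g (Ioc 0 b) := by
    refine (hpow b (hlam.le.trans hb)).mono' hmeas ?_
    filter_upwards [ae_restrict_mem measurableSet_Ioc] with z hz using hA z hz.1 hz.2
  refine ⟨hint, ?_⟩
  rw [← Ioc_union_Ioc_eq_Ioc hlam.le hb, setIntegral_union (Ioc_disjoint_Ioc_of_le le_rfl)
    measurableSet_Ioc (hint.mono_set (Ioc_subset_Ioc_right hb))
    (hint.mono_set (Ioc_subset_Ioc_left hlam.le))]
  refine (abs_add_le _ _).trans (add_le_add ?_ ?_)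
  · rw [← Real.norm_eq_abs]
    refine (norm_integral_le_of_norm_le (hpow lam hlam.le) ?_).trans_eq ?_
    · filter_upwards [ae_restrict_mem measurableSet_Ioc] with z hz
      exact hA z hz.1 (hz.2.trans hb)
    · rw [integral_const_mul, ← intervalIntegral.integral_of_le hlam.le,
        integral_rpow (Or.inl hp), Real.zero_rpow (by linarith), sub_zero]
  · rw [← Real.norm_eq_abs]
    refine (norm_integral_le_of_norm_le hqi' ?_).trans ?_
    · filter_upwards [ae_restrict_mem measurableSet_Ioc] with z hz
      exact hB z (hlam.trans hz.1) hz.2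
    · rw [← integral_Ioi_rpow_of_lt hq hlam, ← integral_const_mul]
      refine setIntegral_mono_set hqi ?_ Ioc_subset_Ioi_self.eventuallyLE
      filter_upwards [ae_restrict_mem measurableSet_Ioi] with z hz
      have : 0 < z := hlam.trans hz
      simp only [Pi.zero_apply]
      positivity

/-- (Uniform bound on `𝓛ρ` when `ρ′` obeys the modulus, `1 < α < 2`.)
If `‖ρ′‖_∞ ≤ M₂` and `ρ′` obeys `ω`, then
`|𝓛ρ(x̃)| ≤ (4c₁/((α−1)²(2−α))) δ λ^{-(α-1)} + (c₃/2) M₂` for every `x̃`. -/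
theorem stmt19 (φ : ℝ → ℝ) (α a₀ c₁ c₂ : ℝ) (h : A12 φ α a₀ c₁ c₂) (hα1 : 1 < α)
    (δ γ lam : ℝ) (hδ : 0 < δ) (hγ0 : 0 < γ) (hγ : γ < δ / 2) (hlam : 0 < lam)
    (hlamr : lam ≤ min a₀ ((6 * c₁ * c₂) ^ (-(1 + α)⁻¹)))
    (M₂ : ℝ)
    (ρ : ℝ → ℝ) (hsm : ContDiff ℝ (⊤ : ℕ∞) ρ) (hper : ∀ x, ρ (x + 1) = ρ x)
    (hM₂ : ∀ x, |deriv ρ x| ≤ M₂)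
    (hobeys : ∀ a b : ℝ, a ≠ b → |deriv ρ a - deriv ρ b| ≤ moc α δ γ lam |a - b|) :
    ∀ x : ℝ,
      |levy φ ρ x| ≤ 4 * c₁ / ((α - 1)^2 * (2 - α)) * δ * lam ^ (-(α - 1))
        + (c₁ * (min a₀ ((6 * c₁ * c₂) ^ (-(1 + α)⁻¹))) ^ (-(1 + α)) + c₂ * (1 + a₀⁻¹)) / 2
          * M₂ := by
  intro x
  have hd : Differentiable ℝ ρ := hsm.differentiable (by simp)
  have hc₁ : 0 < c₁ := zero_lt_one.trans_le h.c₁ge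
  have hα2 := h.αlt
  have hM0 : 0 ≤ M₂ := (abs_nonneg _).trans (hM₂ 0)
  have hosc := abs_sub_le_half_of_periodic hd hper hM₂
  set D : ℝ → ℝ := fun z => 2 * ρ x - ρ (x - z) - ρ (x + z) with hD
  have hDc : Continuous D := by have := hd.continuous; fun_prop
  have hDM (z : ℝ) : |D z| ≤ M₂ := by
    have e : D z = (ρ x - ρ (x - z)) + (ρ x - ρ (x + z)) := by simp only [hD]; ring
    rw [e]
    linarith [abs_add_le (ρ x - ρ (x - z)) (ρ x - ρ (x + z)), hosc x (x - z), hosc x (x + z)]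
  have hob (s : ℝ) (hs : 0 < s) :
      |deriv ρ (x - s) - deriv ρ (x + s)| ≤ moc α δ γ lam (2 * s) := by
    have := hobeys (x - s) (x + s) (by linarith)
    rwa [show x - s - (x + s) = -(2 * s) by ring, abs_neg, abs_of_pos (a := 2 * s) (by positivity)] at this
  have ha0 : 0 < α - 1 := by linarith
  have ha1 : α - 1 < 1 := by linarith
  have hDlin (z : ℝ) (hz : 0 < z) : |D z| ≤ δ * (2 * z / lam) * z := by
    refine abs_second_diff_le hd hz.le (by positivity) ?_
    intro s hs hsz
    refine (hob s hs).trans ((moc_le_linear hδ hγ0 hγ hlam (by positivity)).trans ?_)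
    gcongr
  have hDpow (z : ℝ) (hz : 0 < z) :
      |D z| ≤ δ * (7 / (4 * (α - 1))) * (2 * z / lam) ^ ((α - 1) / 2) * z := by
    refine abs_second_diff_le hd hz.le (by positivity) ?_
    intro s hs hsz
    refine (hob s hs).trans ((moc_le_rpow_s19 hδ hγ0 hγ hlam (by positivity) ha0 ha1).trans ?_)
    gcongr
  have hA (z : ℝ) (hz : 0 < z) (hza : z ≤ a₀) :
      |φ z * D z| ≤ (2 * c₁ * δ / lam) * z ^ (1 - α) := by
    rw [abs_mul]
    refine (mul_le_mul (h.le_rpow_s19 hz hza) (hDlin z hz) (abs_nonneg _) (by positivity)).trans_eq ?_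
    rw [show 1 - α = -(1 + α) + 2 by ring, Real.rpow_add hz, Real.rpow_two]
    ring
  have hB (z : ℝ) (hz : 0 < z) (hza : z ≤ a₀) :
      |φ z * D z| ≤ (c₁ * δ * (7 / (4 * (α - 1))) * (2 ^ ((α - 1) / 2) * lam ^ (-((α - 1) / 2))))
        * z ^ (-1 - (α - 1) / 2) := by
    rw [abs_mul]
    refine (mul_le_mul (h.le_rpow_s19 hz hza) (hDpow z hz) (abs_nonneg _) (by positivity)).trans_eq ?_
    rw [show -1 - (α - 1) / 2 = -(1 + α) + (α - 1) / 2 + 1 by ring, Real.rpow_add hz,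
      Real.rpow_add hz, Real.rpow_one, Real.div_rpow (by positivity) hlam.le,
      Real.mul_rpow (by norm_num) hz.le, Real.rpow_neg hlam.le]
    ring
  have hlama : lam ≤ a₀ := hlamr.trans (min_le_left _ _)
  have hmeas : AEStronglyMeasurable (fun z => φ z * D z) (volume.restrict (Ioc 0 a₀)) :=
    ContinuousOn.aestronglyMeasurable
      ((h.continuousOn.mono fun z hz => hz.1.ne').mul hDc.continuousOn) measurableSet_Ioc
  obtain ⟨hnear, hnearBound⟩ := integral_Ioc_bound_of_rpow hlam hlama (by positivity)
    (by linarith) (by linarith) hmeas hA hB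
  have hφt := h.integrableOn_Ioi_a₀
  have hfar : IntegrableOn (fun z => φ z * D z) (Ioi a₀) :=
    hφt.mul_bdd hDc.aestronglyMeasurable (Eventually.of_forall hDM)
  have hfarBound : |∫ z in Ioi a₀, φ z * D z| ≤ c₂ / 2 * M₂ := by
    rw [← Real.norm_eq_abs]
    refine (norm_integral_le_of_norm_le (hφt.abs.mul_const M₂) ?_).trans ?_
    · refine Eventually.of_forall fun z => ?_
      rw [norm_mul]
      exact mul_le_mul_of_nonneg_left (hDM z) (abs_nonneg _)
    · rw [integral_mul_const]
      exact mul_le_mul_of_nonneg_right h.integral_abs_Ioi_le hM0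
  have hint : IntegrableOn (fun z => φ z * D z) (Ioi 0) := by
    rw [← Ioc_union_Ioi_eq_Ioi h.a₀pos.le]
    exact hnear.union hfar
  rw [h.levy_eq_s19 hd.continuous hosc hint, ← Ioc_union_Ioi_eq_Ioi h.a₀pos.le,
    setIntegral_union Ioc_disjoint_Ioi_same measurableSet_Ioi hnear hfar]
  refine (abs_add_le _ _).trans (add_le_add (hnearBound.trans ?_) (hfarBound.trans ?_))
  · have h2 := two_rpow_le_one_add (t := (α - 1) / 2) (by linarith) (by linarith)
    have e1 : lam ^ (1 - α + 1) = lam ^ (-(α - 1)) * lam := by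
      rw [← Real.rpow_add_one hlam.ne']; ring_nf
    have e2 : lam ^ (-1 - (α - 1) / 2 + 1) = lam ^ (-((α - 1) / 2)) := by ring_nf
    have e3 : lam ^ (-(α - 1)) = lam ^ (-((α - 1) / 2)) * lam ^ (-((α - 1) / 2)) := by
      rw [← Real.rpow_add hlam]; ring_nf
    have hL : 0 < lam ^ (-(α - 1)) := by positivity
    have e4 : (2 * c₁ * δ / lam) * (lam ^ (1 - α + 1) / (1 - α + 1))
        + (c₁ * δ * (7 / (4 * (α - 1))) * (2 ^ ((α - 1) / 2) * lam ^ (-((α - 1) / 2))))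
          * (-lam ^ (-1 - (α - 1) / 2 + 1) / (-1 - (α - 1) / 2 + 1))
        = c₁ * δ * lam ^ (-(α - 1)) * ((2 * (α - 1) ^ 2
          + 7 / 2 * 2 ^ ((α - 1) / 2) * (2 - α)) / ((α - 1) ^ 2 * (2 - α))) := by
      have h3 : 2 - α ≠ 0 := by linarith
      rw [e2, e1, e3, show 1 - α + 1 = 2 - α by ring,
        show -1 - (α - 1) / 2 + 1 = -((α - 1) / 2) by ring]
      field_simp
      ring
    have e5 : 4 * c₁ / ((α - 1) ^ 2 * (2 - α)) * δ * lam ^ (-(α - 1))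
        = c₁ * δ * lam ^ (-(α - 1)) * (4 / ((α - 1) ^ 2 * (2 - α))) := by ring
    have h4 : 0 < 2 - α := by linarith
    rw [e4, e5]
    gcongr
    nlinarith [mul_le_mul_of_nonneg_right h2 h4.le]
  · refine mul_le_mul_of_nonneg_right ?_ hM0
    have hc₂ := h.c₂pos
    have ha₀ := h.a₀pos
    have hr : 0 ≤ c₁ * (min a₀ ((6 * c₁ * c₂) ^ (-(1 + α)⁻¹))) ^ (-(1 + α)) :=
      mul_nonneg hc₁.le (Real.rpow_nonneg (hlam.le.trans hlamr) _)
    have : 0 ≤ c₂ * a₀⁻¹ := by positivity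
    rw [mul_add, mul_one]
    linarith
end
end
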